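/- arXiv:1606.01261 — 2 statements merged into one kernel-verified Lean document; each statement's English description precedes it below -/
import Mathlib

section
/- In the Dual Averaging setting, suppose the strong-convexity modulus satisfies γ(r) ≥ C·r^{1+κ} for all r ≥ 0 with C > 0 and κ > 0, that ‖u_t‖_* ≤ M for all t, and that the learning rates are η_t = η·t^{−β} for some η > 0 and 0 < β < κ. Then for every t ≥ 1 and x ∈ 𝒳, the Dual Averaging iterates satisfy Σ_{τ=1}^t ⟨u_τ, x⟩ − Σ_{τ=1}^t ⟨u_τ, x_τ⟩ ≤ ((h(x) − h̲)/η)·t^β + (κ/(κ−β)) · (η/(2C))^{1/κ} · M^{1+1/κ} · t^{1−β/κ}. -/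
open Finset

lemma da_aux_len (C κ M e q : ℝ) (hC : 0 < C) (hκ : 0 < κ) (hM : 0 < M) (he : 0 < e)
    (hq : 0 ≤ q) :
    C * q ^ (1 + κ) / e = M / 2 * (q * (q / (e * M / (2 * C)) ^ (1 / κ)) ^ κ) := by
  have h0 : 0 < e * M / (2 * C) := by positivity
  rw [Real.div_rpow hq (by positivity), ← Real.rpow_mul h0.le, one_div, inv_mul_cancel₀ hκ.ne',
    Real.rpow_one]
  rcases hq.eq_or_lt with rfl | hq
  · rw [Real.zero_rpow (by positivity)]; simp
  · rw [Real.rpow_add hq, Real.rpow_one]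
    field_simp

/-- main regret bound -/
lemma da_core {X : Type*} [NormedAddCommGroup X] [NormedSpace ℝ X]
    (D : Set X) (H : X → ℝ) (hbar : ℝ) (hlb : ∀ y ∈ D, hbar ≤ H y)
    (C κ M : ℝ) (hC : 0 < C) (hκ : 0 < κ) (hM : 0 < M)
    (g : (X →L[ℝ] ℝ) → X) (hgD : ∀ ξ, g ξ ∈ D)
    (hconv : ∀ (ξ : X →L[ℝ] ℝ), ∀ y ∈ D,
      H (g ξ) + ξ (y - g ξ) + C * ‖y - g ξ‖ ^ (1 + κ) ≤ H y)
    (u : ℕ → X →L[ℝ] ℝ) (hu : ∀ t : ℕ, ‖u t‖ ≤ M)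
    (η : ℕ → ℝ) (hpos : ∀ n, 0 < η n) (hanti : ∀ n, η (n + 1) ≤ η n) (hη0 : η 0 = η 1)
    (ℓ G : ℕ → ℝ) (hℓ : ∀ n, ℓ n = (η n * M / (2 * C)) ^ (1 / κ))
    (hG0 : G 0 = 0) (hG : ∀ n, G (n + 1) = G n + (ℓ n + ℓ (n + 1)) / 2)
    (R : ℕ → X → ℝ) (U : ℕ → X →L[ℝ] ℝ) (hU0 : U 0 = 0) (hU : ∀ n, U (n + 1) = U n + u (n + 1))
    (hR0 : ∀ y, R 0 y = 0)
    (hR : ∀ n y, R (n + 1) y = R n y + u (n + 1) (y - g (η n • U n))) :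
    ∀ t, ∀ y ∈ D, R t y ≤ (H y - hbar) / η t + M * G t := by
  have hℓpos : ∀ n, 0 < ℓ n := fun n => by
    rw [hℓ]; have := hpos n; positivity
  have hRd : ∀ n y z, R n y - R n z = U n (y - z) := by
    intro n
    induction n with
    | zero => intro y z; simp [hR0, hU0]
    | succ n ih =>
      intro y z
      have := ih y z
      rw [hR, hR, hU, add_apply, ← this]
      simp only [map_sub]; ring
  have hub : ∀ n y, u n y ≤ M * ‖y‖ := fun n y =>
    (le_abs_self _).trans (((u n).le_opNorm y).trans
      (mul_le_mul_of_nonneg_right (hu n) (norm_nonneg _)))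
  have hantiM : Antitone η := antitone_nat_of_succ_le hanti
  have hlen : ∀ n q, 0 ≤ q → C * q ^ (1 + κ) / η n = M / 2 * (q * (q / ℓ n) ^ κ) := by
    intro n q hq; rw [hℓ]; exact da_aux_len C κ M _ q hC hκ hM (hpos n) hq
  -- star
  have star : ∀ n, (∀ y ∈ D, R n y ≤ (H y - hbar) / η n + M * G n) → ∀ y ∈ D,
      R n y ≤ (H y - hbar) / η n + M * G n
        - M / 2 * (‖y - g (η n • U n)‖ * (‖y - g (η n • U n)‖ / ℓ n) ^ κ) := by
    intro n ih y hy
    have h1 := ih _ (hgD (η n • U n))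
    have h2 := hconv (η n • U n) y hy
    have h3 := hRd n y (g (η n • U n))
    rw [← hlen n _ (norm_nonneg _)]
    rw [smul_apply, smul_eq_mul, ← h3] at h2
    have hp := hpos n
    have h4 : R n y - R n (g (η n • U n)) ≤
        (H y - H (g (η n • U n)) - C * ‖y - g (η n • U n)‖ ^ (1 + κ)) / η n := by
      rw [le_div_iff₀ hp]; linarith
    have h5 : (H y - H (g (η n • U n)) - C * ‖y - g (η n • U n)‖ ^ (1 + κ)) / η n
      = (H y - hbar) / η n - (H (g (η n • U n)) - hbar) / η n
        - C * ‖y - g (η n • U n)‖ ^ (1 + κ) / η n := by ring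
    linarith
  -- power facts
  have hpow1 : 1 ≤ κ → ∀ n q, ℓ n ≤ q → q * (q / ℓ n) ≤ q * (q / ℓ n) ^ κ := by
    intro h1 n q hq
    have hp := hℓpos n
    have : 1 ≤ q / ℓ n := by rwa [le_div_iff₀ hp, one_mul]
    exact mul_le_mul_of_nonneg_left (Real.self_le_rpow_of_one_le this h1) (hp.le.trans hq)
  have hsq : ∀ n q, 2 * q - ℓ n ≤ q * (q / ℓ n) := by
    intro n q
    have hp := hℓpos n
    have : q * (q / ℓ n) - (2 * q - ℓ n) = (q - ℓ n) ^ 2 / ℓ n := by field_simp; ring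
    have h2 : 0 ≤ (q - ℓ n) ^ 2 / ℓ n := by positivity
    linarith
  have hP0 : ∀ y ∈ D, R 0 y ≤ (H y - hbar) / η 0 + M * G 0 := by
    intro y hy
    rw [hR0, hG0]
    have := hlb y hy
    have := div_nonneg (sub_nonneg.2 this) (hpos 0).le
    linarith
  have hKm : ∀ y ∈ D, ∀ n m, n ≤ m → (H y - hbar) / η n ≤ (H y - hbar) / η m := by
    intro y hy n m hnm
    exact div_le_div_of_nonneg_left (sub_nonneg.2 (hlb y hy)) (hpos m) (hantiM hnm)
  rcases le_total κ 1 with hk | hk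
  · intro t
    induction t with
    | zero => exact hP0
    | succ n ih =>
      intro y hy
      have hp := hpos n
      set w := g (η n • U n) with hw
      set z := g (η n • U (n + 1)) with hz
      have a1 := star n ih z (hgD _)
      rw [← hw] at a1
      have a2 := hconv (η n • U (n + 1)) y hy
      have a3 := hconv (η n • U (n + 1)) w (hgD _)
      have a4 := hconv (η n • U n) z (hgD _)
      rw [← hz] at a2 a3
      rw [← hw] at a4
      rw [norm_sub_rev w z] at a3
      simp only [smul_apply, smul_eq_mul] at a2 a3 a4
      rw [← hRd] at a2
      have a6 := hub (n + 1) (z - w)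
      set q := ‖z - w‖ with hq
      have hq0 : 0 ≤ q := norm_nonneg _
      have e1 : U (n + 1) (w - z) = - U n (z - w) - u (n + 1) (z - w) := by
        rw [hU]; simp only [add_apply, map_sub]; ring
      rw [e1] at a3
      have a5 : 2 * (C * q ^ (1 + κ)) ≤ η n * u (n + 1) (z - w) := by nlinarith
      have a7 : C * q ^ (1 + κ) / η n ≤ M * q / 2 := by
        rw [div_le_iff₀ hp]; nlinarith
      rw [hlen n q hq0] at a7
      have hlp := hℓpos n
      have hqle : q ≤ ℓ n := by
        by_contra hcon
        push Not at hcon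
        have : 1 < q / ℓ n := by rwa [lt_div_iff₀ hlp, one_mul]
        have := Real.one_lt_rpow this hκ
        have hqp : 0 < q := hlp.trans hcon
        have := mul_lt_mul_of_pos_left this (mul_pos hM hqp)
        nlinarith
      have hpw : q * (q / ℓ n) ≤ q * (q / ℓ n) ^ κ := by
        rcases hq0.eq_or_lt with h0 | h0
        · rw [← h0]; simp
        · refine mul_le_mul_of_nonneg_left ?_ hq0
          have h1 : q / ℓ n ≤ 1 := by rwa [div_le_iff₀ hlp, one_mul]
          have := Real.rpow_le_rpow_of_exponent_ge (div_pos h0 hlp) h1 hk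
          rwa [Real.rpow_one] at this
      have a8 := hsq n q
      have a9 : R (n + 1) y - R (n + 1) z ≤ (H y - hbar) / η n - (H z - hbar) / η n := by
        rw [← sub_div, le_div_iff₀ hp]
        have : 0 ≤ C * ‖y - z‖ ^ (1 + κ) := by positivity
        linarith
      have a10 := hR n z
      rw [← hw] at a10
      have a11 := hKm y hy n (n + 1) (Nat.le_succ n)
      rw [hG]
      have hl1 := hℓpos (n + 1)
      have b1 : M * (2 * q - ℓ n) ≤ M * (q * (q / ℓ n) ^ κ) :=
        mul_le_mul_of_nonneg_left (a8.trans hpw) hM.le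
      have b2 : 0 < M * ℓ (n + 1) := mul_pos hM hl1
      linarith
  · intro t
    induction t using Nat.strong_induction_on with
    | _ t ih =>
    rcases Nat.eq_zero_or_pos t with rfl | ht
    · exact hP0
    intro y hy
    by_contra hcon
    push Not at hcon
    have hT : ∀ n, n < t → M / 2 * (‖y - g (η n • U n)‖ * (‖y - g (η n • U n)‖ / ℓ n) ^ κ) <
        R t y - R n y - M * (G t - G n) := by
      intro n hn
      have h1 := star n (ih n hn) y hy
      have h2 := hKm y hy n t hn.le
      linarith
    have hcl : ∀ k n, n + k = t → R t y - R n y - M * (G t - G n) ≤ M / 2 * (ℓ n - ℓ t) := by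
      intro k
      induction k with
      | zero => intro n hn; obtain rfl : n = t := by omega
                simp
      | succ k ihk =>
        intro n hn
        have h1 := ihk (n + 1) (by omega)
        have h2 := hT n (by omega)
        have h3 := hub (n + 1) (y - g (η n • U n))
        rw [hR, hG] at h1
        set q := ‖y - g (η n • U n)‖
        have hlt := mul_pos hM (hℓpos t)
        have h5 : q ≤ ℓ n := by
          by_contra hc
          push Not at hc
          have b1 := mul_le_mul_of_nonneg_left ((hsq n q).trans (hpow1 hk n q hc.le)) hM.le
          linarith
        have h6 := mul_le_mul_of_nonneg_left h5 hM.le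
        linarith
    have h1 := hcl (t - 1) 1 (by omega)
    have h2 := hconv 0 y hy
    have h3 := hub 1 (y - g 0)
    have e1 := hR 0 y
    have e2 := hG 0
    rw [hU0, smul_zero, hR0] at e1
    rw [hG0] at e2
    simp only [zero_add] at e1 e2
    have e3 : ℓ 0 = ℓ 1 := by rw [hℓ, hℓ, hη0]
    rw [e3] at e2
    rw [e1, e2] at h1
    have h4 : C * ‖y - g 0‖ ^ (1 + κ) / η t ≤ (H y - hbar) / η t := by
      apply div_le_div_of_nonneg_right _ (hpos t).le
      have := hlb _ (hgD 0)
      simp at h2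
      linarith
    rw [hlen t _ (norm_nonneg _)] at h4
    have hlt1 : ℓ t ≤ ℓ 1 := by
      rw [hℓ, hℓ]
      have := hantiM ht
      have := hpos t
      gcongr
    set q := ‖y - g 0‖
    have hq0 : 0 ≤ q := norm_nonneg _
    have b0 := mul_le_mul_of_nonneg_left hlt1 hM.le
    have b00 := mul_pos hM (hℓpos t)
    rcases le_total (ℓ t) q with hc | hc
    · have b1 := mul_le_mul_of_nonneg_left ((hsq t q).trans (hpow1 hk t q hc)) hM.le
      linarith
    · have b1 := mul_le_mul_of_nonneg_left hc hM.le
      have : 0 ≤ M / 2 * (q * (q / ℓ t) ^ κ) := by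
        have := hℓpos t
        positivity
      linarith

lemma da_mid (b v : ℝ) (hb : 0 < b) (hb1 : b < 1) (hv : 0 ≤ v) (hv1 : v < 1) :
    2 * b * v ≤ (1 + v) ^ b - (1 - v) ^ b := by
  have hd : ∀ x ∈ Set.Ico (0:ℝ) 1, HasDerivAt (fun v : ℝ => (1 + v) ^ b - (1 - v) ^ b - 2 * b * v)
      (b * (1 + x) ^ (b - 1) + b * (1 - x) ^ (b - 1) - 2 * b) x := by
    intro x hx
    have h1 : HasDerivAt (fun v : ℝ => (1 + v) ^ b) (1 * b * (1 + x) ^ (b - 1)) x :=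
      ((hasDerivAt_id x).const_add 1).rpow_const (Or.inl (by have := hx.1; simp; linarith))
    have h2 : HasDerivAt (fun v : ℝ => (1 - v) ^ b) (-1 * b * (1 - x) ^ (b - 1)) x :=
      ((hasDerivAt_id x).const_sub 1).rpow_const (Or.inl (by have := hx.2; simp; linarith))
    have h3 : HasDerivAt (fun v : ℝ => 2 * b * v) (2 * b * 1) x := (hasDerivAt_id x).const_mul _
    exact ((h1.sub h2).sub h3).congr_deriv (by ring)
  have hm : MonotoneOn (fun v : ℝ => (1 + v) ^ b - (1 - v) ^ b - 2 * b * v) (Set.Ico 0 1) := by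
    apply monotoneOn_of_deriv_nonneg (convex_Ico 0 1)
    · exact fun x hx => (hd x hx).continuousAt.continuousWithinAt
    · exact fun x hx => (hd x (interior_subset hx)).differentiableAt.differentiableWithinAt
    · intro x hx
      have hx' := interior_subset hx
      rw [(hd x hx').deriv]
      have p1 : 0 < 1 + x := by linarith [hx'.1]
      have p2 : 0 < 1 - x := by linarith [hx'.2]
      have k1 : 1 ≤ (1 + x) ^ (b - 1) * (1 - x) ^ (b - 1) := by
        rw [← Real.mul_rpow p1.le p2.le]
        apply Real.one_le_rpow_of_pos_of_le_one_of_nonpos (by positivity) (by nlinarith [sq_nonneg x])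
          (by linarith)
      have q1 : 0 < (1 + x) ^ (b - 1) := by positivity
      have q2 : 0 < (1 - x) ^ (b - 1) := by positivity
      have : 2 ≤ (1 + x) ^ (b - 1) + (1 - x) ^ (b - 1) := by
        nlinarith [sq_nonneg ((1 + x) ^ (b - 1) - (1 - x) ^ (b - 1))]
      nlinarith
  have := hm (Set.mem_Ico.2 ⟨le_refl 0, one_pos⟩) (Set.mem_Ico.2 ⟨hv, hv1⟩) hv
  simp at this
  linarith

lemma da_mid2 (b x : ℝ) (hb : 0 < b) (hb1 : b < 1) (hx : 1 ≤ x) :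
    b * x ^ (b - 1) ≤ (x + 1 / 2) ^ b - (x - 1 / 2) ^ b := by
  have hx0 : 0 < x := by linarith
  have h := da_mid b (1 / (2 * x)) hb hb1 (by positivity)
    (by rw [div_lt_one (by positivity)]; linarith)
  have e1 : x + 1 / 2 = x * (1 + 1 / (2 * x)) := by field_simp
  have e2 : x - 1 / 2 = x * (1 - 1 / (2 * x)) := by field_simp
  have p2 : 0 ≤ 1 - 1 / (2 * x) := by
    rw [sub_nonneg, div_le_one (by positivity)]; linarith
  rw [e1, e2, Real.mul_rpow hx0.le (by positivity), Real.mul_rpow hx0.le p2, ← mul_sub,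
    Real.rpow_sub hx0, Real.rpow_one]
  have := mul_le_mul_of_nonneg_left h (Real.rpow_nonneg hx0.le b)
  refine le_trans (le_of_eq ?_) this
  field_simp

lemma da_up (b x : ℝ) (hb : 0 < b) (hb1 : b < 1) (hx : 1 ≤ x) :
    (x + 1 / 2) ^ b ≤ x ^ b + b / 2 * x ^ (b - 1) := by
  have hx0 : 0 < x := by linarith
  have h := rpow_one_add_le_one_add_mul_self (s := 1 / (2 * x)) (p := b)
    (by have : 0 < 1 / (2 * x) := by positivity
        linarith) hb.le hb1.le
  have e1 : x + 1 / 2 = x * (1 + 1 / (2 * x)) := by field_simp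
  rw [e1, Real.mul_rpow hx0.le (by positivity), Real.rpow_sub hx0, Real.rpow_one]
  refine (mul_le_mul_of_nonneg_left h (Real.rpow_nonneg hx0.le b)).trans (le_of_eq ?_)
  field_simp

lemma da_three (b : ℝ) (hb : 0 < b) (hb1 : b < 1) : 3 / 2 * b ≤ (3 / 2 : ℝ) ^ b := by
  have h := rpow_one_add_le_one_add_mul_self (s := 1 / 2) (p := 1 - b)
    (by norm_num) (by linarith) (by linarith)
  have e : (1 + 1 / 2 : ℝ) = 3 / 2 := by norm_num
  rw [e, Real.rpow_sub (by norm_num), Real.rpow_one] at h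
  have hp : 0 < (3 / 2 : ℝ) ^ b := by positivity
  rw [div_le_iff₀ hp] at h
  nlinarith

/-- trapezoid sum -/
lemma da_sum (b : ℝ) (hb : 0 < b) (hb1 : b < 1) (e : ℕ → ℝ) (he1 : e 1 = 1)
    (he : ∀ n : ℕ, 1 ≤ n →
      e (n + 1) = e n + ((n : ℝ) ^ (b - 1) + ((n + 1 : ℕ) : ℝ) ^ (b - 1)) / 2) (t : ℕ) (ht : 1 ≤ t) :
    b * e t ≤ (t : ℝ) ^ b := by
  have inv : ∀ n : ℕ, 1 ≤ n → b * e n ≤ ((n : ℝ) + 1 / 2) ^ b - b / 2 * (n : ℝ) ^ (b - 1)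
      + 3 / 2 * b - (3 / 2 : ℝ) ^ b := by
    intro n hn
    induction n, hn using Nat.le_induction with
    | base => rw [he1]; norm_num; linarith
    | succ n hn ih =>
      rw [he n hn]
      have hn' : (1 : ℝ) ≤ n := by exact_mod_cast hn
      have := da_mid2 b ((n + 1 : ℕ) : ℝ) hb hb1 (by push_cast; linarith)
      have e2 : ((n + 1 : ℕ) : ℝ) - 1 / 2 = (n : ℝ) + 1 / 2 := by push_cast; ring
      rw [e2] at this
      linarith
  have h1 := inv t ht
  have h2 := da_up b t hb hb1 (by exact_mod_cast ht)
  have h3 := da_three b hb hb1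
  linarith


/-- **Dual Averaging regret bound with polynomial learning rates.**
In the Dual Averaging setting with modulus `γ(r) ≥ C r^{1+κ}` (`C, κ > 0`), bounded
rewards `‖u_t‖⋆ ≤ M`, and learning rates `η_t = η t^{-β}` (`η > 0`, `0 < β < κ`),
for every `t ≥ 1` and `x ∈ 𝒳`:
`Σ_{τ=1}^t ⟨u_τ, x⟩ - Σ_{τ=1}^t ⟨u_τ, x_τ⟩ ≤ ((h(x) - h̲)/η) t^β
  + (κ/(κ-β)) (η/(2C))^{1/κ} M^{1+1/κ} t^{1-β/κ}`. -/
theorem stmt4 {X : Type*} [NormedAddCommGroup X] [NormedSpace ℝ X]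
    (h : X → EReal) (hproper : ∀ y : X, h y ≠ ⊥)
    (hbar : ℝ) (hbar_inf : (⨅ y : X, h y) = (hbar : EReal))
    (γ : ℝ → ℝ) (hγ0 : γ 0 = 0) (hγnn : ∀ r : ℝ, 0 ≤ r → 0 ≤ γ r)
    (C κ : ℝ) (hC : 0 < C) (hκ : 0 < κ)
    (hγlb : ∀ r : ℝ, 0 ≤ r → C * r ^ (1 + κ) ≤ γ r)
    (g : (X →L[ℝ] ℝ) → X)
    (hgdom : ∀ ξ : X →L[ℝ] ℝ, h (g ξ) ≠ ⊤)
    (hconv : ∀ (ξ : X →L[ℝ] ℝ) (x : X),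
      h (g ξ) + ((ξ (x - g ξ) + γ ‖x - g ξ‖ : ℝ) : EReal) ≤ h x)
    (M : ℝ) (u : ℕ → X →L[ℝ] ℝ) (hu : ∀ t : ℕ, ‖u t‖ ≤ M)
    (ηc β : ℝ) (hηc : 0 < ηc) (hβ : 0 < β) (hβκ : β < κ)
    (η : ℕ → ℝ) (hη : ∀ t : ℕ, 1 ≤ t → η t = ηc * (t : ℝ) ^ (-β)) (hη0 : η 0 = η 1)
    (x : ℕ → X)
    (hx : ∀ t : ℕ, 1 ≤ t → x t = g ((η (t - 1)) • (∑ τ ∈ Icc 1 (t - 1), u τ))) :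
    ∀ (t : ℕ), 1 ≤ t → ∀ (x' : X) (c : ℝ), h x' = (c : EReal) →
      (∑ τ ∈ Icc 1 t, u τ x') - ∑ τ ∈ Icc 1 t, u τ (x τ) ≤
        ((c - hbar) / ηc) * (t : ℝ) ^ β +
          (κ / (κ - β)) * (ηc / (2 * C)) ^ (1 / κ) * M ^ (1 + 1 / κ) *
            (t : ℝ) ^ (1 - β / κ) := by
  intro t ht x' c hc
  have hM0 : 0 ≤ M := (norm_nonneg _).trans (hu 0)
  have hle : ∀ y : X, (hbar : EReal) ≤ h y := fun y => by rw [← hbar_inf]; exact iInf_le _ y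
  have hcb : hbar ≤ c := by
    have := hle x'; rw [hc] at this; exact_mod_cast this
  have ht0 : (0 : ℝ) < t := by exact_mod_cast ht
  rcases hM0.eq_or_lt with rfl | hM
  · have hu0 : ∀ n, u n = 0 := fun n => norm_le_zero_iff.1 (hu n)
    rw [Real.zero_rpow (by positivity)]
    simp only [hu0]
    simp
    have := sub_nonneg.2 hcb
    positivity
  have hηpos : ∀ n, 0 < η n := by
    intro n
    rcases Nat.eq_zero_or_pos n with rfl | hn
    · rw [hη0, hη 1 le_rfl]; simpa using hηc
    · rw [hη n hn]
      have : (0 : ℝ) < n := by exact_mod_cast hn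
      positivity
  have hanti : ∀ n, η (n + 1) ≤ η n := by
    intro n
    rcases Nat.eq_zero_or_pos n with rfl | hn
    · rw [hη0]
    · rw [hη n hn, hη (n + 1) (by omega)]
      have : (0 : ℝ) < n := by exact_mod_cast hn
      apply mul_le_mul_of_nonneg_left _ hηc.le
      apply Real.rpow_le_rpow_of_nonpos this _ (by linarith)
      push_cast; linarith
  set ℓ : ℕ → ℝ := fun n => (η n * M / (2 * C)) ^ (1 / κ) with hℓ
  set G : ℕ → ℝ := fun n => ∑ i ∈ range n, (ℓ i + ℓ (i + 1)) / 2 with hG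
  have hreal : ∀ y : X, h y ≠ ⊤ → h y = ((h y).toReal : EReal) := fun y hy =>
    (EReal.coe_toReal hy (hproper y)).symm
  have key := da_core {y | h y ≠ ⊤} (fun y => (h y).toReal) hbar
    (by
      intro y hy
      have := hle y
      rw [hreal y hy] at this
      exact_mod_cast this)
    C κ M hC hκ hM g hgdom
    (by
      intro ξ y hy
      have h1 := hconv ξ y
      rw [hreal y hy, hreal _ (hgdom ξ), ← EReal.coe_add, EReal.coe_le_coe_iff] at h1
      have := hγlb ‖y - g ξ‖ (norm_nonneg _)
      linarith)
    u hu η hηpos hanti hη0 ℓ G (fun n => rfl) (by simp [hG])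
    (fun n => by simp only [hG]; rw [sum_range_succ])
    (fun n y => ∑ τ ∈ Icc 1 n, u τ (y - x τ)) (fun n => ∑ τ ∈ Icc 1 n, u τ)
    (by simp) (fun n => by rw [sum_Icc_succ_top (by omega)]) (by simp)
    (fun n y => by
      rw [sum_Icc_succ_top (by omega), hx (n + 1) (by omega)]
      simp)
    t x' (by simp [hc])
  simp only [hc, EReal.toReal_coe, map_sub, sum_sub_distrib] at key
  refine key.trans (add_le_add (le_of_eq ?_) ?_)
  · rw [hη t ht, Real.rpow_neg ht0.le]
    field_simp
  · set L : ℝ := (ηc * M / (2 * C)) ^ (1 / κ) with hL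
    have hLpos : 0 < L := by positivity
    have hbb : 0 < 1 - β / κ := by rw [sub_pos, div_lt_one hκ]; exact hβκ
    have hbb1 : 1 - β / κ < 1 := by have : 0 < β / κ := by positivity
                                    linarith
    have hℓn : ∀ n : ℕ, 1 ≤ n → ℓ n = L * (n : ℝ) ^ ((1 - β / κ) - 1) := by
      intro n hn
      have hn0 : (0 : ℝ) < n := by exact_mod_cast hn
      simp only [hℓ, hL]
      rw [hη n hn, show ηc * (n : ℝ) ^ (-β) * M / (2 * C) = ηc * M / (2 * C) * (n : ℝ) ^ (-β) by ring,
        Real.mul_rpow (by positivity) (by positivity), ← Real.rpow_mul hn0.le]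
      congr 2
      ring
    have hℓ0 : ℓ 0 = ℓ 1 := by simp only [hℓ, hη0]
    have hℓ1 : ℓ 1 = L := by rw [hℓn 1 le_rfl]; simp
    have hs := da_sum (1 - β / κ) hbb hbb1 (fun n => G n / L)
      (by simp [hG, hℓ0, hℓ1, hLpos.ne'])
      (by
        intro n hn
        simp only [hG]
        rw [sum_range_succ, hℓn n hn, hℓn (n + 1) (by omega)]
        field_simp)
      t ht
    have hML : (ηc / (2 * C)) ^ (1 / κ) * M ^ (1 + 1 / κ) = M * L := by
      rw [hL, show ηc * M / (2 * C) = ηc / (2 * C) * M by ring,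
        Real.mul_rpow (by positivity) hM.le, Real.rpow_add hM, Real.rpow_one]
      ring
    have hk : κ / (κ - β) = 1 / (1 - β / κ) := by
      have : κ - β ≠ 0 := by linarith
      field_simp
    rw [mul_assoc (κ / (κ - β)), hML, hk]
    have h2 : G t / L ≤ (t : ℝ) ^ (1 - β / κ) / (1 - β / κ) := by
      rw [le_div_iff₀ hbb]; linarith
    rw [div_le_iff₀ hLpos] at h2
    refine (mul_le_mul_of_nonneg_left h2 hM.le).trans (le_of_eq ?_)
    ring
end

section
/- In the continuous two-player zero-sum game setting, suppose the game 𝒢 = (S1, S2, u) has value V and a unique Nash equilibrium (z1*, z2*), and let (s^1_t), (s^2_t) be sequences of plays along which both players have sublinear realized regret. Then the marginal empirical distributions of play x̂^i_t := (1/t)·Σ_{τ=1}^t δ_{s^i_τ} converge weakly: x̂^1_t ⇀ z1* and x̂^2_t ⇀ z2* as t → ∞. -/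
open Finset MeasureTheory Filter

lemma aux_emp {S : Type*} [MetricSpace S] [CompactSpace S] [MeasurableSpace S] [BorelSpace S]
    (x : ℕ → S) (t : ℕ) : ∃ μ : ProbabilityMeasure S, 1 ≤ t → ∀ f : C(S, ℝ),
      ∫ a, f a ∂(μ : Measure S) = (1 / (t : ℝ)) * ∑ τ ∈ Icc 1 t, f (x τ) := by
  rcases Nat.lt_or_ge t 1 with h | h
  · exact ⟨⟨Measure.dirac (x 0), inferInstance⟩, fun h' => by omega⟩
  have ht : (t : ENNReal) ≠ 0 := by
    simp; omega
  refine ⟨⟨(t : ENNReal)⁻¹ • ∑ τ ∈ Icc 1 t, Measure.dirac (x τ), ⟨?_⟩⟩, fun _ f => ?_⟩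
  · simp [Measure.finsetSum_apply]
    exact ENNReal.inv_mul_cancel ht (by simp)
  · simp only [ProbabilityMeasure.coe_mk, integral_smul_measure]
    rw [integral_finsetSum_measure]
    · simp
    · intro i _
      exact f.continuous.integrable_of_hasCompactSupport (HasCompactSupport.of_compactSpace _)

lemma aux_conv {S ι : Type*} [MetricSpace S] [CompactSpace S] [MeasurableSpace S] [BorelSpace S]
    (x : ℕ → S) (z : ProbabilityMeasure S) (g : ι → C(S, ℝ)) (V : ℝ)
    (hg : ∀ i, ∀ ε > 0, ∀ᶠ t : ℕ in atTop, (1 / (t : ℝ)) * ∑ τ ∈ Icc 1 t, g i (x τ) ≤ V + ε)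
    (hu : ∀ ν : ProbabilityMeasure S, (∀ i, ∫ a, g i a ∂(ν : Measure S) ≤ V) → ν = z)
    (f : C(S, ℝ)) :
    Tendsto (fun t : ℕ => (1 / (t : ℝ)) * ∑ τ ∈ Icc 1 t, f (x τ)) atTop
        (nhds (∫ a, f a ∂(z : Measure S))) := by
  choose μ hμ using aux_emp x
  rw [tendsto_iff_ultrafilter]
  intro U hU
  obtain ⟨ν, -, hν⟩ := isCompact_univ.ultrafilter_le_nhds (U.map μ) (by simp)
  have hT : Tendsto μ U (nhds ν) := hν
  rw [ProbabilityMeasure.tendsto_iff_forall_integral_tendsto] at hT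
  have key : ∀ f : C(S, ℝ), Tendsto (fun t : ℕ => (1 / (t : ℝ)) * ∑ τ ∈ Icc 1 t, f (x τ)) U
      (nhds (∫ a, f a ∂(ν : Measure S))) := by
    intro f
    refine (hT (BoundedContinuousFunction.mkOfCompact f)).congr' ?_
    filter_upwards [hU (eventually_ge_atTop 1)] with t ht
    simpa using hμ t ht f
  have : ν = z := by
    apply hu
    intro i
    refine le_of_forall_pos_le_add fun ε hε => ?_
    exact le_of_tendsto (key (g i)) (hU (hg i ε hε))
  rw [← this]
  exact key f

lemma aux_reg {A B : Type*} [MetricSpace A] [CompactSpace A] [Nonempty A]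
    [MetricSpace B] [CompactSpace B] (v : A → B → ℝ) (M : ℝ) (hM : ∀ a b, |v a b| ≤ M)
    (p : ℕ → A) (q : ℕ → B)
    (hreg : limsup (fun t : ℕ => (1 / (t : ℝ)) *
        ((⨆ a : A, ∑ τ ∈ Icc 1 t, v a (q τ)) -
          ∑ τ ∈ Icc 1 t, v (p τ) (q τ))) atTop ≤ 0) (ε : ℝ) (hε : 0 < ε) :
    ∀ᶠ t : ℕ in atTop, ∀ a, (1 / (t : ℝ)) * ∑ τ ∈ Icc 1 t, v a (q τ) ≤
      (1 / (t : ℝ)) * ∑ τ ∈ Icc 1 t, v (p τ) (q τ) + ε := by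
  have hs : ∀ (t : ℕ) (w : ℕ → A), |∑ τ ∈ Icc 1 t, v (w τ) (q τ)| ≤ t * M := by
    intro t w
    refine (abs_sum_le_sum_abs _ _).trans ((sum_le_card_nsmul _ _ M fun i _ => hM _ _).trans ?_)
    simp
  have hbdd : IsBoundedUnder (· ≤ ·) atTop (fun t : ℕ => (1 / (t : ℝ)) *
        ((⨆ a : A, ∑ τ ∈ Icc 1 t, v a (q τ)) - ∑ τ ∈ Icc 1 t, v (p τ) (q τ))) := by
    refine isBoundedUnder_of_eventually_le (a := 2 * M) ?_
    filter_upwards [eventually_ge_atTop 1] with t ht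
    have ht' : (0 : ℝ) < t := by exact_mod_cast ht
    have h1 : (⨆ a : A, ∑ τ ∈ Icc 1 t, v a (q τ)) ≤ t * M :=
      ciSup_le fun a => (abs_le.1 (hs t fun _ => a)).2
    have h2 := (abs_le.1 (hs t p)).1
    rw [one_div, inv_mul_le_iff₀ ht']
    linarith
  have := eventually_lt_of_limsup_lt (lt_of_le_of_lt hreg hε) hbdd
  filter_upwards [this] with t ht a
  have h1 : ∑ τ ∈ Icc 1 t, v a (q τ) ≤ ⨆ a : A, ∑ τ ∈ Icc 1 t, v a (q τ) :=
    le_ciSup (f := fun a : A => ∑ τ ∈ Icc 1 t, v a (q τ))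
      ⟨t * M, by rintro _ ⟨a, rfl⟩; exact (abs_le.1 (hs t fun _ => a)).2⟩ a
  have h2 := mul_le_mul_of_nonneg_left h1 (show (0 : ℝ) ≤ 1 / (t : ℝ) by positivity)
  rw [mul_sub] at ht
  linarith

lemma aux_side {S1 S2 : Type*}
    [MetricSpace S1] [CompactSpace S1] [Nonempty S1]
    [MetricSpace S2] [CompactSpace S2] [Nonempty S2] [MeasurableSpace S2] [BorelSpace S2]
    (u : C(S1 × S2, ℝ)) (V : ℝ) (z : ProbabilityMeasure S2)
    (hz : ∀ a, ∫ b, u (a, b) ∂(z : Measure S2) ≤ V)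
    (hu : ∀ ν : ProbabilityMeasure S2, (∀ a, ∫ b, u (a, b) ∂(ν : Measure S2) ≤ V) → ν = z)
    (s1 : ℕ → S1) (s2 : ℕ → S2)
    (h1 : ∀ ε > 0, ∀ᶠ t : ℕ in atTop, ∀ a, (1 / (t : ℝ)) * ∑ τ ∈ Icc 1 t, u (a, s2 τ) ≤
      (1 / (t : ℝ)) * ∑ τ ∈ Icc 1 t, u (s1 τ, s2 τ) + ε)
    (h2 : ∀ ε > 0, ∀ᶠ t : ℕ in atTop, ∀ b, (1 / (t : ℝ)) * ∑ τ ∈ Icc 1 t, -u (s1 τ, b) ≤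
      (1 / (t : ℝ)) * ∑ τ ∈ Icc 1 t, -u (s1 τ, s2 τ) + ε) (f : C(S2, ℝ)) :
    Tendsto (fun t : ℕ => (1 / (t : ℝ)) * ∑ τ ∈ Icc 1 t, f (s2 τ)) atTop
        (nhds (∫ b, f b ∂(z : Measure S2))) := by
  have hint : ∀ g : C(S2, ℝ), Integrable g (z : Measure S2) := fun g =>
    g.continuous.integrable_of_hasCompactSupport (HasCompactSupport.of_compactSpace _)
  refine aux_conv s2 z (fun a => u.curry a) V ?_ hu f
  intro a ε hε
  filter_upwards [h1 (ε / 2) (by linarith), h2 (ε / 2) (by linarith), eventually_ge_atTop 1]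
    with t ht1 ht2 ht
  have ht' : (0 : ℝ) < t := by exact_mod_cast ht
  have hi : ∀ τ, Integrable (fun b => u (s1 τ, b)) (z : Measure S2) :=
    fun τ => hint (u.curry (s1 τ))
  have hI : ∫ b, (1 / (t : ℝ)) * ∑ τ ∈ Icc 1 t, u (s1 τ, b) ∂(z : Measure S2) ≤ V := by
    rw [integral_const_mul, integral_finsetSum _ (fun τ _ => hi τ), one_div, inv_mul_le_iff₀ ht']
    refine (sum_le_card_nsmul _ _ V fun i _ => hz _).trans ?_
    simp
  have hle : (1 / (t : ℝ)) * ∑ τ ∈ Icc 1 t, u (a, s2 τ) - ε ≤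
      ∫ b, (1 / (t : ℝ)) * ∑ τ ∈ Icc 1 t, u (s1 τ, b) ∂(z : Measure S2) := by
    have hc : ∫ _b, ((1 / (t : ℝ)) * ∑ τ ∈ Icc 1 t, u (a, s2 τ) - ε) ∂(z : Measure S2) =
      (1 / (t : ℝ)) * ∑ τ ∈ Icc 1 t, u (a, s2 τ) - ε := by simp
    rw [← hc]
    refine integral_mono (integrable_const _)
      ((integrable_finsetSum _ fun τ _ => hi τ).const_mul _) fun b => ?_
    have := ht1 a
    have h3 := ht2 b
    simp only [sum_neg_distrib, mul_neg] at h3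
    simp only
    linarith
  simp only [ContinuousMap.curry_apply]
  linarith

/-- **Weak convergence of the empirical distributions of play under a unique Nash
equilibrium.** In a continuous two-player zero-sum game `(S1, S2, u)` with value `V` and
a unique Nash equilibrium `(z1*, z2*)`, if both players have sublinear realized regret
along the plays, then the marginal empirical distributions of play converge weakly:
`x̂¹_t ⇀ z1*` and `x̂²_t ⇀ z2*`, i.e. the empirical averages of every continuous
function converge to its integral against `zᵢ*`. -/
theorem stmt16 {S1 S2 : Type*}
    [MetricSpace S1] [CompactSpace S1] [Nonempty S1] [MeasurableSpace S1] [BorelSpace S1]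
    [MetricSpace S2] [CompactSpace S2] [Nonempty S2] [MeasurableSpace S2] [BorelSpace S2]
    (u : C(S1 × S2, ℝ)) (V : ℝ)
    (hval₁ : (⨆ x1 : ProbabilityMeasure S1, ⨅ x2 : ProbabilityMeasure S2,
        ∫ s, u s ∂((x1 : Measure S1).prod (x2 : Measure S2))) = V)
    (hval₂ : (⨅ x2 : ProbabilityMeasure S2, ⨆ x1 : ProbabilityMeasure S1,
        ∫ s, u s ∂((x1 : Measure S1).prod (x2 : Measure S2))) = V)
    -- `(z1*, z2*)` is the unique Nash equilibrium
    (z1s : ProbabilityMeasure S1) (z2s : ProbabilityMeasure S2)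
    (hNE : (⨆ x1 : ProbabilityMeasure S1,
        ∫ s, u s ∂((x1 : Measure S1).prod (z2s : Measure S2))) = V ∧
      (⨅ x2 : ProbabilityMeasure S2,
        ∫ s, u s ∂((z1s : Measure S1).prod (x2 : Measure S2))) = V)
    (huniq : ∀ (z1 : ProbabilityMeasure S1) (z2 : ProbabilityMeasure S2),
      (⨆ x1 : ProbabilityMeasure S1,
          ∫ s, u s ∂((x1 : Measure S1).prod (z2 : Measure S2))) = V →
      (⨅ x2 : ProbabilityMeasure S2,
          ∫ s, u s ∂((z1 : Measure S1).prod (x2 : Measure S2))) = V →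
      z1 = z1s ∧ z2 = z2s)
    (s1 : ℕ → S1) (s2 : ℕ → S2)
    -- both players have sublinear realized regret
    (hreg1 : limsup (fun t : ℕ => (1 / (t : ℝ)) *
        ((⨆ a : S1, ∑ τ ∈ Icc 1 t, u (a, s2 τ)) -
          ∑ τ ∈ Icc 1 t, u (s1 τ, s2 τ))) atTop ≤ 0)
    (hreg2 : limsup (fun t : ℕ => (1 / (t : ℝ)) *
        ((⨆ b : S2, ∑ τ ∈ Icc 1 t, -u (s1 τ, b)) -
          ∑ τ ∈ Icc 1 t, -u (s1 τ, s2 τ))) atTop ≤ 0) :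
    (∀ f : C(S1, ℝ),
      Tendsto (fun t : ℕ => (1 / (t : ℝ)) * ∑ τ ∈ Icc 1 t, f (s1 τ)) atTop
        (nhds (∫ a, f a ∂(z1s : Measure S1)))) ∧
    (∀ f : C(S2, ℝ),
      Tendsto (fun t : ℕ => (1 / (t : ℝ)) * ∑ τ ∈ Icc 1 t, f (s2 τ)) atTop
        (nhds (∫ b, f b ∂(z2s : Measure S2)))) := by

  obtain ⟨M, hM⟩ : ∃ M, ∀ s, |u s| ≤ M := ⟨‖u‖, fun s => u.norm_coe_le_norm s⟩
  have hint : ∀ (x1 : ProbabilityMeasure S1) (x2 : ProbabilityMeasure S2),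
      Integrable u ((x1 : Measure S1).prod (x2 : Measure S2)) := fun x1 x2 =>
    u.continuous.integrable_of_hasCompactSupport (HasCompactSupport.of_compactSpace _)
  have hbd : ∀ (x1 : ProbabilityMeasure S1) (x2 : ProbabilityMeasure S2),
      |∫ s, u s ∂((x1 : Measure S1).prod (x2 : Measure S2))| ≤ M := by
    intro x1 x2
    have := norm_integral_le_of_norm_le_const (μ := (x1 : Measure S1).prod (x2 : Measure S2))
      (f := u) (C := M) (Eventually.of_forall hM)
    simpa using this
  have hU : ∀ x2 : ProbabilityMeasure S2, BddAbove (Set.range fun x1 : ProbabilityMeasure S1 =>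
      ∫ s, u s ∂((x1 : Measure S1).prod (x2 : Measure S2))) := fun x2 =>
    ⟨M, by rintro _ ⟨a, rfl⟩; exact (abs_le.1 (hbd _ _)).2⟩
  have hL : ∀ x1 : ProbabilityMeasure S1, BddBelow (Set.range fun x2 : ProbabilityMeasure S2 =>
      ∫ s, u s ∂((x1 : Measure S1).prod (x2 : Measure S2))) := fun x1 =>
    ⟨-M, by rintro _ ⟨a, rfl⟩; exact (abs_le.1 (hbd _ _)).1⟩
  have hle : ∀ x1 : ProbabilityMeasure S1,
      ∫ s, u s ∂((x1 : Measure S1).prod (z2s : Measure S2)) ≤ V := fun x1 =>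
    hNE.1 ▸ le_ciSup (hU z2s) x1
  have hge : ∀ x2 : ProbabilityMeasure S2,
      V ≤ ∫ s, u s ∂((z1s : Measure S1).prod (x2 : Measure S2)) := fun x2 =>
    hNE.2 ▸ ciInf_le (hL z1s) x2
  have : Nonempty (ProbabilityMeasure S1) := ⟨z1s⟩
  have : Nonempty (ProbabilityMeasure S2) := ⟨z2s⟩
  have r1 := aux_reg (fun a b => u (a, b)) M (fun a b => hM _) s1 s2 hreg1
  have r2 := aux_reg (fun b a => -u (a, b)) M (fun a b => by simpa using hM _) s2 s1 hreg2
  constructor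
  · refine aux_side (S1 := S2) (S2 := S1) ⟨fun p => -u (p.2, p.1), by fun_prop⟩ (-V) z1s ?_ ?_
      s2 s1 r2 (by simpa using r1)
    · intro b
      obtain ⟨d, hd⟩ : ∃ d : ProbabilityMeasure S2, (d : Measure S2) = Measure.dirac b :=
        ⟨⟨Measure.dirac b, inferInstance⟩, rfl⟩
      have := hge d
      rw [integral_prod _ (hint z1s d)] at this
      simp only [hd, integral_dirac] at this
      simpa [integral_neg] using this
    · intro ν hν
      refine (huniq ν z2s hNE.1 (le_antisymm ?_ ?_)).1
      · exact (ciInf_le (hL ν) z2s).trans (hle ν)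
      · refine le_ciInf fun x2 => ?_
        rw [integral_prod_symm _ (hint _ _)]
        have hc : ∫ _b, V ∂(x2 : Measure S2) = V := by simp
        rw [← hc]
        refine integral_mono (integrable_const _) (hint ν x2).integral_prod_right fun b => ?_
        have := hν b
        simpa [integral_neg] using this
  · refine aux_side u V z2s ?_ ?_ s1 s2 r1 r2
    · intro a
      obtain ⟨d, hd⟩ : ∃ d : ProbabilityMeasure S1, (d : Measure S1) = Measure.dirac a :=
        ⟨⟨Measure.dirac a, inferInstance⟩, rfl⟩
      have := hle d
      rw [integral_prod_symm _ (hint d z2s)] at this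
      simp only [hd, integral_dirac] at this
      simpa using this
    · intro ν hν
      refine (huniq z1s ν (le_antisymm ?_ ?_) hNE.2).2
      · refine ciSup_le fun x1 => ?_
        rw [integral_prod _ (hint _ _)]
        have hc : ∫ _b, V ∂(x1 : Measure S1) = V := by simp
        rw [← hc]
        exact integral_mono (hint x1 ν).integral_prod_left (integrable_const _) fun a => hν a
      · exact (hge ν).trans (le_ciSup (hU ν) z1s)
end
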